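/- Suppose the coefficients depend only on x_1 and are smooth in x_1: A^{αβ}(t,x) = Ā^{αβ}(x_1) with each Ā^{αβ} a C^∞ function of one real variable satisfying the bound and ellipticity conditions with constant δ. Suppose u : ℝ^{1+d} → ℝ^m is smooth and satisfies −u_t + D_α(A^{αβ}D_βu) = 0 weakly in Q_4, and set U = Σ_{β=1}^d Ā^{1β}(x_1) D_βu. Then ‖U‖_{L_2(Q_2)} + ‖D_1 U‖_{L_2(Q_2)} ≤ N ‖Du‖_{L_2(Q_3)}, where N = N(d,m,δ) does not depend on any smoothness norms of Ā. -/

import Mathlib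

open MeasureTheory Metric Set Function
open scoped ENNReal NNReal RealInnerProductSpace BigOperators

noncomputable section

/-- `ℝ^d` with the Euclidean norm. -/
abbrev Ed (d : ℕ) : Type := EuclideanSpace ℝ (Fin d)
/-- `ℝ^m` with the Euclidean norm. -/
abbrev Em (m : ℕ) : Type := EuclideanSpace ℝ (Fin m)
/-- `m × m` real matrices, viewed as linear operators on `ℝ^m`. -/
abbrev CLM (m : ℕ) : Type := Em m →L[ℝ] Em m

/-- Spatial partial derivative `D_α u` of a function on `ℝ^{1+d}`. -/
def pd {d : ℕ} {F : Type*} [NormedAddCommGroup F] [NormedSpace ℝ F]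
    (α : Fin d) (u : ℝ × Ed d → F) (q : ℝ × Ed d) : F :=
  fderiv ℝ u q (0, EuclideanSpace.single α 1)

/-- Time derivative `∂_t u` of a function on `ℝ^{1+d}`. -/
def pt {d : ℕ} {F : Type*} [NormedAddCommGroup F] [NormedSpace ℝ F]
    (u : ℝ × Ed d → F) (q : ℝ × Ed d) : F :=
  fderiv ℝ u q (1, 0)

/-- `|Du|²`, the squared Euclidean norm of the spatial gradient. -/
def gradSq {d m : ℕ} (u : ℝ × Ed d → Em m) (q : ℝ × Ed d) : ℝ :=
  ∑ α, ‖pd α u q‖ ^ 2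

/-- The parabolic cylinder `Q_r(t,x) = (t - r², t) × B_r(x)`. -/
def Qc {d : ℕ} (r t : ℝ) (x : Ed d) : Set (ℝ × Ed d) :=
  Ioo (t - r ^ 2) t ×ˢ ball x r

/-- `Q_r = Q_r(0,0)`. -/
def Qc0 {d : ℕ} (r : ℝ) : Set (ℝ × Ed d) := Qc r 0 0

/-- Boundedness by `δ⁻¹` together with the ellipticity condition with constant `δ`
for a family of `m × m` matrices. -/
def EllipticPt (δ : ℝ) {d m : ℕ} (a : Fin d → Fin d → CLM m) : Prop :=
  (∀ α β, ‖a α β‖ ≤ δ⁻¹) ∧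
  ∀ ξ : Fin d → Em m, δ * ∑ α, ‖ξ α‖ ^ 2 ≤ ∑ α, ∑ β, ⟪ξ α, a α β (ξ β)⟫

/-- Measurable, bounded, uniformly elliptic coefficients on `ℝ^{1+d}`. -/
def Coeffs (δ : ℝ) {d m : ℕ} (A : Fin d → Fin d → ℝ × Ed d → CLM m) : Prop :=
  (∀ α β, Measurable (A α β)) ∧ ∀ q, EllipticPt δ (fun α β => A α β q)

/-- The class `𝒜`: measurable, bounded, uniformly elliptic coefficients depending on
one real variable. -/
def CoeffsOne (δ : ℝ) {d m : ℕ} (Ab : Fin d → Fin d → ℝ → CLM m) : Prop :=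
  (∀ α β, Measurable (Ab α β)) ∧ ∀ s, EllipticPt δ (fun α β => Ab α β s)

/-- The class `Ψ` of `C^{1,1}` diffeomorphisms of `ℝ^d`: `ψ` and its inverse `φ`
are `C^1` with Lipschitz first derivatives, and `|Dψ| + |D²ψ| ≤ δ⁻¹`,
`|Dφ| + |D²φ| ≤ δ⁻¹` (where the second derivative is measured by the Lipschitz
constant of the first derivative). -/
def IsPsi (δ : ℝ) {d : ℕ} (ψ φ : Ed d → Ed d) : Prop :=
  Function.LeftInverse φ ψ ∧ Function.RightInverse φ ψ ∧
  ContDiff ℝ 1 ψ ∧ ContDiff ℝ 1 φ ∧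
  ∃ K K' : ℝ≥0, LipschitzWith K (fderiv ℝ ψ) ∧ LipschitzWith K' (fderiv ℝ φ) ∧
    (∀ x, ‖fderiv ℝ ψ x‖ + (K : ℝ) ≤ δ⁻¹) ∧ ∀ y, ‖fderiv ℝ φ y‖ + (K' : ℝ) ≤ δ⁻¹

/-- `U = Σ_β Ā^{1β}(x₁) D_β u`. -/
def Ubar {d m : ℕ} [NeZero d] (Ab : Fin d → Fin d → ℝ → CLM m)
    (u : ℝ × Ed d → Em m) (q : ℝ × Ed d) : Em m :=
  ∑ β, Ab 0 β (q.2 0) (pd β u q)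

section helpers
variable {d m : ℕ}

lemma dir_smooth {F : Type*} [NormedAddCommGroup F] [NormedSpace ℝ F]
    {v : ℝ × Ed d → F} (hv : ContDiff ℝ (⊤ : ℕ∞) v) (e : ℝ × Ed d) :
    ContDiff ℝ (⊤ : ℕ∞) (fun q => fderiv ℝ v q e) :=
  (hv.fderiv_right (m := ((⊤ : ℕ∞) : WithTop ℕ∞)) (by simp)).clm_apply contDiff_const

lemma pd_smooth {F : Type*} [NormedAddCommGroup F] [NormedSpace ℝ F]
    {v : ℝ × Ed d → F} (hv : ContDiff ℝ (⊤ : ℕ∞) v) (α : Fin d) :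
    ContDiff ℝ (⊤ : ℕ∞) (pd α v) := dir_smooth hv _

lemma pt_smooth {F : Type*} [NormedAddCommGroup F] [NormedSpace ℝ F]
    {v : ℝ × Ed d → F} (hv : ContDiff ℝ (⊤ : ℕ∞) v) :
    ContDiff ℝ (⊤ : ℕ∞) (pt v) := dir_smooth hv _

lemma dir_comm {F : Type*} [NormedAddCommGroup F] [NormedSpace ℝ F]
    {v : ℝ × Ed d → F} (hv : ContDiff ℝ (⊤ : ℕ∞) v) (e f q : ℝ × Ed d) :
    fderiv ℝ (fun p => fderiv ℝ v p e) q f = fderiv ℝ (fun p => fderiv ℝ v p f) q e := by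
  have h1 : Differentiable ℝ (fderiv ℝ v) :=
    (hv.fderiv_right (m := ((⊤ : ℕ∞) : WithTop ℕ∞)) (by simp)).differentiable (by simp)
  have hs : IsSymmSndFDerivAt ℝ v q :=
    hv.contDiffAt.isSymmSndFDerivAt (by simp; exact WithTop.coe_le_coe.2 le_top)
  rw [fderiv_clm_apply (h1 q) (differentiableAt_const _),
    fderiv_clm_apply (h1 q) (differentiableAt_const _)]
  simp
  exact hs f e

/-- The integral of a directional derivative of a compactly supported function vanishes. -/
lemma integral_dir_zero {h : ℝ × Ed d → ℝ} (hh : ContDiff ℝ (⊤ : ℕ∞) h)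
    (hc : HasCompactSupport h) (e : ℝ × Ed d) : ∫ q, fderiv ℝ h q e = 0 := by
  have : (volume : Measure (ℝ × Ed d)).IsAddHaarMeasure := Measure.prod.instIsAddHaarMeasure _ _
  have hi : Integrable (fun q => fderiv ℝ h q e) :=
    (dir_smooth hh e).continuous.integrable_of_hasCompactSupport (hc.fderiv_apply ℝ e)
  have := integral_mul_fderiv_eq_neg_fderiv_mul_of_integrable (μ := (volume : Measure (ℝ × Ed d)))
    (f := fun _ => (1:ℝ)) (g := h) (v := e) (by simp) (by simpa using hi)
    (by simpa using hh.continuous.integrable_of_hasCompactSupport hc) (by simp)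
    (fun x _ => hh.differentiable (by simp) x)
  simpa using this

lemma pd_inner {f g : ℝ × Ed d → Em m} {w : ℝ × Ed d → ℝ} (hf : ContDiff ℝ (⊤ : ℕ∞) f)
    (hg : ContDiff ℝ (⊤ : ℕ∞) g) (hw : ContDiff ℝ (⊤ : ℕ∞) w) (n : ℕ) (e q : ℝ × Ed d) :
    fderiv ℝ (fun p => w p ^ (n+1) * ⟪f p, g p⟫) q e =
      (n+1) * w q ^ n * fderiv ℝ w q e * ⟪f q, g q⟫
      + w q ^ (n+1) * (⟪fderiv ℝ f q e, g q⟫ + ⟪f q, fderiv ℝ g q e⟫) := by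
  have h1 := hf.differentiable (by simp) q
  have h2 := hg.differentiable (by simp) q
  have h3 := hw.differentiable (by simp) q
  have := ((h3.hasFDerivAt.pow (n+1)).mul (h1.hasFDerivAt.inner ℝ h2.hasFDerivAt)).fderiv
  have h4 := congrArg (fun L => L e) this
  refine Eq.trans ?_ (h4.trans ?_)
  · rfl
  · simp [fderivInnerCLM_apply]
    ring

lemma coeff_smooth [NeZero d] {a : ℝ → CLM m} (ha : ContDiff ℝ (⊤ : ℕ∞) a) :
    ContDiff ℝ (⊤ : ℕ∞) (fun q : ℝ × Ed d => a (q.2 0)) := by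
  apply ha.comp
  exact (EuclideanSpace.proj (𝕜 := ℝ) (0 : Fin d)).contDiff.comp contDiff_snd

/-- The flux `W_α v = Σ_β A^{αβ} D_β v`. -/
def Wf [NeZero d] (Ab : Fin d → Fin d → ℝ → CLM m)
    (α : Fin d) (v : ℝ × Ed d → Em m) (q : ℝ × Ed d) : Em m :=
  ∑ β, Ab α β (q.2 0) (pd β v q)

lemma Wf_smooth [NeZero d] {Ab : Fin d → Fin d → ℝ → CLM m}
    (hA : ∀ α β, ContDiff ℝ (⊤ : ℕ∞) (Ab α β)) (α : Fin d)
    {v : ℝ × Ed d → Em m} (hv : ContDiff ℝ (⊤ : ℕ∞) v) :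
    ContDiff ℝ (⊤ : ℕ∞) (Wf Ab α v) := by
  unfold Wf
  exact ContDiff.sum fun β _ => (coeff_smooth (hA α β)).clm_apply (pd_smooth hv β)

lemma Wf_comm [NeZero d] {Ab : Fin d → Fin d → ℝ → CLM m}
    (hA : ∀ α β, ContDiff ℝ (⊤ : ℕ∞) (Ab α β)) (α : Fin d)
    {v : ℝ × Ed d → Em m} (hv : ContDiff ℝ (⊤ : ℕ∞) v) (e q : ℝ × Ed d) (he : e.2 0 = 0) :
    fderiv ℝ (Wf Ab α v) q e = Wf Ab α (fun p => fderiv ℝ v p e) q := by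
  have hd : ∀ β, DifferentiableAt ℝ (fun q : ℝ × Ed d => Ab α β (q.2 0)) q := fun β =>
    (coeff_smooth (hA α β)).differentiable (by simp) q
  have hp : ∀ β, DifferentiableAt ℝ (pd β v) q := fun β =>
    (pd_smooth hv β).differentiable (by simp) q
  have h0 : ∀ β, fderiv ℝ (fun q : ℝ × Ed d => Ab α β (q.2 0)) q e = 0 := by
    intro β
    have hL : HasFDerivAt (fun q : ℝ × Ed d => q.2 0)
      ((EuclideanSpace.proj (𝕜 := ℝ) (0 : Fin d)).comp (ContinuousLinearMap.snd ℝ ℝ (Ed d))) q :=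
      ((EuclideanSpace.proj (𝕜 := ℝ) (0 : Fin d)).comp
        (ContinuousLinearMap.snd ℝ ℝ (Ed d))).hasFDerivAt
    have := (((hA α β).differentiable (by simp) (q.2 0)).hasFDerivAt.comp q hL).fderiv
    have h2 := congrArg (fun L => L e) this
    refine Eq.trans ?_ (h2.trans ?_)
    · rfl
    · simp [he]
  have : Wf Ab α v = fun q => ∑ β, Ab α β (q.2 0) (pd β v q) := rfl
  rw [this, fderiv_fun_sum (fun β _ => (hd β).clm_apply (hp β))]
  simp only [_root_.sum_apply, Wf]
  refine Finset.sum_congr rfl fun β _ => ?_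
  rw [fderiv_clm_apply (hd β) (hp β)]
  simp [h0]
  congr 1
  exact dir_comm hv _ _ _

/-- pointwise solution. -/
def Sol [NeZero d] (Ab : Fin d → Fin d → ℝ → CLM m) (Ω : Set (ℝ × Ed d))
    (v : ℝ × Ed d → Em m) : Prop :=
  ∀ q ∈ Ω, pt v q = ∑ α, pd α (Wf Ab α v) q

lemma Sol.dir [NeZero d] {Ab : Fin d → Fin d → ℝ → CLM m}
    (hA : ∀ α β, ContDiff ℝ (⊤ : ℕ∞) (Ab α β)) {Ω : Set (ℝ × Ed d)} (hΩ : IsOpen Ω)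
    {v : ℝ × Ed d → Em m} (hv : ContDiff ℝ (⊤ : ℕ∞) v) (hs : Sol Ab Ω v)
    (e : ℝ × Ed d) (he : e.2 0 = 0) : Sol Ab Ω (fun p => fderiv ℝ v p e) := by
  intro q hq
  have hev : pt v =ᶠ[nhds q] fun p => ∑ α, pd α (Wf Ab α v) p := by
    filter_upwards [hΩ.mem_nhds hq] with p hp using hs p hp
  have h1 := congrArg (fun L : (ℝ × Ed d) →L[ℝ] Em m => L e) (hev.fderiv_eq (𝕜 := ℝ))
  have h2 : pt (fun p => fderiv ℝ v p e) q = fderiv ℝ (pt v) q e := dir_comm hv _ _ _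
  rw [h2]
  refine h1.trans ?_
  rw [fderiv_fun_sum (fun α _ => (pd_smooth (Wf_smooth hA α hv) α).differentiable (by simp) q)]
  simp only [_root_.sum_apply]
  refine Finset.sum_congr rfl fun α _ => ?_
  have h3 : fderiv ℝ (pd α (Wf Ab α v)) q e
      = pd α (fun p => fderiv ℝ (Wf Ab α v) p e) q := dir_comm (Wf_smooth hA α hv) _ _ _
  rw [h3]
  congr 1
  funext p
  exact Wf_comm hA α hv e p he

lemma Wf_bound [NeZero d] {δ : ℝ} (hδ : 0 < δ) {Ab : Fin d → Fin d → ℝ → CLM m}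
    (hA : CoeffsOne δ Ab) (α : Fin d) (v : ℝ × Ed d → Em m) (q : ℝ × Ed d) :
    ‖Wf Ab α v q‖ ^ 2 ≤ (d / δ ^ 2) * gradSq v q := by
  have h1 : ‖Wf Ab α v q‖ ≤ ∑ β, δ⁻¹ * ‖pd β v q‖ := by
    refine (norm_sum_le _ _).trans (Finset.sum_le_sum fun β _ => ?_)
    refine (ContinuousLinearMap.le_opNorm _ _).trans ?_
    gcongr
    exact (hA.2 _).1 α β
  rw [← Finset.mul_sum] at h1
  have h3 := sq_sum_le_card_mul_sum_sq (s := (Finset.univ : Finset (Fin d)))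
    (f := fun β => ‖pd β v q‖)
  simp at h3
  calc ‖Wf Ab α v q‖ ^ 2 ≤ (δ⁻¹ * ∑ β, ‖pd β v q‖) ^ 2 := by gcongr
    _ = δ⁻¹ ^ 2 * (∑ β, ‖pd β v q‖) ^ 2 := by ring
    _ ≤ δ⁻¹ ^ 2 * (d * ∑ β, ‖pd β v q‖ ^ 2) := by gcongr
    _ = _ := by unfold gradSq; field_simp

lemma gradSq_nonneg (v : ℝ × Ed d → Em m) (q : ℝ × Ed d) : 0 ≤ gradSq v q :=
  Finset.sum_nonneg fun _ _ => by positivity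

lemma gradSq_cont {v : ℝ × Ed d → Em m} (hv : ContDiff ℝ (⊤ : ℕ∞) v) :
    Continuous (gradSq v) := by
  unfold gradSq
  exact continuous_finsetSum _ fun α _ => ((pd_smooth hv α).continuous.norm).pow 2

/-- Cutoff functions with quantitative bounds. -/
structure Cut (K : ℝ) (η : ℝ × Ed d → ℝ) : Prop where
  smooth : ContDiff ℝ (⊤ : ℕ∞) η
  cpt : HasCompactSupport η
  nonneg : ∀ q, 0 ≤ η q
  le_one : ∀ q, η q ≤ 1
  ptle : ∀ q, pt η q ≤ K
  pdle : ∀ α q, |pd α η q| ≤ K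
  supp : ∀ q, η q ≠ 0 → q ∈ Qc0 3

lemma Cut.integrable {K : ℝ} {η : ℝ × Ed d → ℝ} (hη : Cut K η) {f : ℝ × Ed d → ℝ}
    (hf : Continuous f) (n : ℕ) : Integrable (fun q => η q ^ (n+1) * f q) := by
  refine ((hη.smooth.continuous.pow _).mul hf).integrable_of_hasCompactSupport ?_
  refine HasCompactSupport.mul_right ?_
  exact hη.cpt.comp_left (g := fun x => x ^ (n+1)) (by simp)

lemma Cut.compact {K : ℝ} {η : ℝ × Ed d → ℝ} (hη : Cut K η) (f : ℝ × Ed d → ℝ)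
    (n : ℕ) : HasCompactSupport (fun q => η q ^ (n+1) * f q) := by
  refine HasCompactSupport.mul_right ?_
  exact hη.cpt.comp_left (g := fun x => x ^ (n+1)) (by simp)

lemma Qc0_mono {r s : ℝ} (hr : 0 ≤ r) (h : r ≤ s) : (Qc0 r : Set (ℝ × Ed d)) ⊆ Qc0 s := by
  unfold Qc0 Qc
  refine prod_mono (Ioo_subset_Ioo ?_ le_rfl) (ball_subset_ball h)
  nlinarith

lemma young_aux (η k c x y p : ℝ) (hc : 0 < c) (K : ℝ) (hk : |k| ≤ K) (hη : 0 ≤ η)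
    (hp : |p| ≤ x * y) :
    -(4 * η ^ 3 * k * p) ≤ c * (η ^ 4 * y ^ 2) + 4 * K ^ 2 / c * (η ^ 2 * x ^ 2) := by
  have hK : 0 ≤ K := (abs_nonneg _).trans hk
  have h1 : |k * p| ≤ K * (x * y) := by
    rw [abs_mul]; gcongr
  have h2 : -(k * p) ≤ K * (x * y) := (neg_le_abs _).trans h1
  have h3 : -(4 * η ^ 3 * k * p) ≤ 4 * η ^ 3 * (K * (x * y)) := by
    have : 0 ≤ 4 * η ^ 3 := by positivity
    nlinarith
  refine h3.trans ?_
  have h4 : 0 ≤ (c * (η ^ 2 * y) - 2 * K * (η * x)) ^ 2 / c := by positivity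
  have h5 : (c * (η ^ 2 * y) - 2 * K * (η * x)) ^ 2 / c =
    c * (η ^ 4 * y ^ 2) + 4 * K ^ 2 / c * (η ^ 2 * x ^ 2) - 4 * η ^ 3 * (K * (x * y)) := by
    field_simp; ring
  linarith

lemma caccioppoli [NeZero d] {δ : ℝ} (hδ : 0 < δ) {K : ℝ} (hK : 0 ≤ K) :
    ∃ C : ℝ, 0 < C ∧ ∀ (Ab : Fin d → Fin d → ℝ → CLM m), CoeffsOne δ Ab →
      (∀ α β, ContDiff ℝ (⊤ : ℕ∞) (Ab α β)) →
      ∀ v : ℝ × Ed d → Em m, ContDiff ℝ (⊤ : ℕ∞) v → Sol Ab (Qc0 4) v →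
      ∀ η, Cut K η → ∫ q, η q ^ 4 * gradSq v q ≤ C * ∫ q, η q ^ 2 * ‖v q‖ ^ 2 := by
  have hd : (0:ℝ) < d := by exact_mod_cast Nat.pos_of_ne_zero (NeZero.ne d)
  set M : ℝ := d / δ ^ 2 with hM
  have hMp : 0 < M := by positivity
  set c : ℝ := δ / (2 * d * M) with hc
  have hcp : 0 < c := by positivity
  set C0 : ℝ := 2 * K + d * (4 * K ^ 2 / c) + 1 with hC0
  have hC0p : 0 < C0 := by positivity
  refine ⟨2 / δ * C0, by positivity, ?_⟩
  intro Ab hA hAs v hv hs η hη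
  set G : ℝ × Ed d → ℝ := fun q => 1 / 2 * pt (fun p => η p ^ (3+1) * ⟪v p, v p⟫) q
    - ∑ α, pd α (fun p => η p ^ (3+1) * ⟪v p, Wf Ab α v p⟫) q with hG
  have hsm : ∀ (n : ℕ) {g : ℝ × Ed d → Em m}, ContDiff ℝ (⊤ : ℕ∞) g →
      ContDiff ℝ (⊤ : ℕ∞) (fun p => η p ^ (n+1) * ⟪v p, g p⟫) := fun n g hg =>
    (hη.smooth.pow _).mul (hv.inner ℝ hg)
  have hsW := fun α => Wf_smooth hAs α hv
  have hIntg : ∀ {g : ℝ × Ed d → Em m}, ContDiff ℝ (⊤ : ℕ∞) g → ∀ e,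
      Integrable (fun q => fderiv ℝ (fun p => η p ^ (3+1) * ⟪v p, g p⟫) q e) := fun hg e =>
    (dir_smooth (hsm 3 hg) e).continuous.integrable_of_hasCompactSupport
      ((hη.compact _ 3).fderiv_apply ℝ e)
  have hGi : Integrable G := by
    refine ((hIntg hv _).const_mul _).sub (integrable_finsetSum _ fun α _ => hIntg (hsW α) _)
  have hG0 : ∫ q, G q = 0 := by
    have j1 : Integrable (fun q => pt (fun p => η p ^ (3+1) * ⟪v p, v p⟫) q) := hIntg hv _
    have j2 : ∀ α, Integrable (fun q => pd α (fun p => η p ^ (3+1) * ⟪v p, Wf Ab α v p⟫) q) :=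
      fun α => hIntg (hsW α) _
    simp only [hG]
    rw [integral_sub (j1.const_mul _) (integrable_finsetSum _ fun α _ => j2 α),
      integral_const_mul, integral_finsetSum _ (fun α _ => j2 α)]
    have h1 : ∫ q, pt (fun p => η p ^ (3+1) * ⟪v p, v p⟫) q = 0 :=
      integral_dir_zero (hsm 3 hv) (hη.compact _ 3) _
    have h2 : ∀ α, ∫ q, pd α (fun p => η p ^ (3+1) * ⟪v p, Wf Ab α v p⟫) q = 0 := fun α =>
      integral_dir_zero (hsm 3 (hsW α)) (hη.compact _ 3) _
    rw [h1, Finset.sum_congr rfl (fun α _ => h2 α)]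
    simp
  have key : ∀ q, δ / 2 * (η q ^ 4 * gradSq v q) ≤ C0 * (η q ^ 2 * ‖v q‖ ^ 2) - G q := by
    intro q
    have hGq : G q = 2 * η q ^ 3 * pt η q * ‖v q‖ ^ 2
        - ∑ α, 4 * η q ^ 3 * pd α η q * ⟪v q, Wf Ab α v q⟫
        - η q ^ 4 * ∑ α, ⟪pd α v q, Wf Ab α v q⟫ := by
      have e1 : pt (fun p => η p ^ (3+1) * ⟪v p, v p⟫) q =
        4 * η q ^ 3 * pt η q * ‖v q‖ ^ 2 + 2 * (η q ^ 4 * ⟪v q, pt v q⟫) := by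
        have := pd_inner hv hv hη.smooth 3 (1, 0) q
        refine this.trans ?_
        rw [real_inner_comm (v q) (fderiv ℝ v q (1, 0)), real_inner_self_eq_norm_sq]
        unfold pt; norm_num; ring
      have e2 : ∀ α, pd α (fun p => η p ^ (3+1) * ⟪v p, Wf Ab α v p⟫) q =
          4 * η q ^ 3 * pd α η q * ⟪v q, Wf Ab α v q⟫
          + η q ^ 4 * ⟪pd α v q, Wf Ab α v q⟫ + η q ^ 4 * ⟪v q, pd α (Wf Ab α v) q⟫ := by
        intro α
        refine (pd_inner hv (hsW α) hη.smooth 3 _ q).trans ?_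
        unfold pd; norm_num; ring
      have e3 : η q ^ 4 * ⟪v q, pt v q⟫ = η q ^ 4 * ∑ α, ⟪v q, pd α (Wf Ab α v) q⟫ := by
        by_cases h0 : η q = 0
        · simp [h0]
        · rw [hs q (Qc0_mono (by norm_num) (by norm_num) (hη.supp q h0)), inner_sum]
      simp only [hG]
      rw [e1, e3]
      simp only [e2, Finset.sum_add_distrib, ← Finset.mul_sum]
      ring
    have hell : δ * gradSq v q ≤ ∑ α, ⟪pd α v q, Wf Ab α v q⟫ := by
      have := (hA.2 (q.2 0)).2 (fun α => pd α v q)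
      simpa only [Wf, inner_sum, gradSq] using this
    have hell2 : η q ^ 4 * (δ * gradSq v q) ≤ η q ^ 4 * ∑ α, ⟪pd α v q, Wf Ab α v q⟫ :=
      mul_le_mul_of_nonneg_left hell (by positivity)
    have ht : 2 * η q ^ 3 * pt η q * ‖v q‖ ^ 2 ≤ 2 * K * (η q ^ 2 * ‖v q‖ ^ 2) := by
      have h0 := hη.nonneg q
      have h1 := hη.le_one q
      have h2 := hη.ptle q
      have h3 : η q * pt η q ≤ K := by
        rcases le_total 0 (pt η q) with h | h <;> nlinarith
      have h4 : 0 ≤ 2 * (η q ^ 2 * ‖v q‖ ^ 2) := by positivity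
      nlinarith
    have hsum : -∑ α, 4 * η q ^ 3 * pd α η q * ⟪v q, Wf Ab α v q⟫ ≤
        δ / 2 * (η q ^ 4 * gradSq v q) + d * (4 * K ^ 2 / c) * (η q ^ 2 * ‖v q‖ ^ 2) := by
      rw [← Finset.sum_neg_distrib]
      calc _ ≤ ∑ α : Fin d, (c * (η q ^ 4 * (M * gradSq v q))
              + 4 * K ^ 2 / c * (η q ^ 2 * ‖v q‖ ^ 2)) := by
            refine Finset.sum_le_sum fun α _ => ?_
            refine (young_aux _ _ c ‖v q‖ ‖Wf Ab α v q‖ _ hcp K (hη.pdle α q) (hη.nonneg q)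
              (abs_real_inner_le_norm _ _)).trans ?_
            gcongr
            exact Wf_bound hδ hA α v q
        _ = _ := by
            simp only [Finset.sum_const, Finset.card_univ, Fintype.card_fin, nsmul_eq_mul]
            rw [hc]; field_simp
    have hpos : 0 ≤ η q ^ 2 * ‖v q‖ ^ 2 := by positivity
    rw [hGq, hC0]
    nlinarith
  have i1 := hη.integrable (gradSq_cont hv) 3
  have i2 := hη.integrable (hv.continuous.norm.pow 2) 1
  have h := integral_mono (i1.const_mul (δ / 2)) ((i2.const_mul C0).sub hGi) key
  have h' : δ / 2 * ∫ q, η q ^ 4 * gradSq v q ≤ C0 * ∫ q, η q ^ 2 * ‖v q‖ ^ 2 := by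
    rw [integral_const_mul] at h
    refine h.trans_eq ?_
    have e := integral_sub (i2.const_mul C0) hGi
    rw [hG0, sub_zero, integral_const_mul] at e
    exact e
  calc ∫ q, η q ^ 4 * gradSq v q = 2 / δ * (δ / 2 * ∫ q, η q ^ 4 * gradSq v q) := by field_simp
    _ ≤ 2 / δ * (C0 * ∫ q, η q ^ 2 * ‖v q‖ ^ 2) := by gcongr
    _ = _ := by ring

lemma sol_of_weak [NeZero d] {Ab : Fin d → Fin d → ℝ → CLM m}
    (hAs : ∀ α β, ContDiff ℝ (⊤ : ℕ∞) (Ab α β)) {u : ℝ × Ed d → Em m}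
    (hu : ContDiff ℝ (⊤ : ℕ∞) u) {Ω : Set (ℝ × Ed d)} (hΩ : IsOpen Ω)
    (hw : ∀ φt : ℝ × Ed d → Em m, ContDiff ℝ (⊤ : ℕ∞) φt → HasCompactSupport φt →
      tsupport φt ⊆ Ω →
      ∫ q, (⟪u q, pt φt q⟫ - ∑ α, ∑ β, ⟪Ab α β (q.2 0) (pd β u q), pd α φt q⟫) = 0) :
    Sol Ab Ω u := by
  intro q0 hq0
  obtain ⟨χ, hχ1, hχ2, hχ3, hχ4, hχ5⟩ :=
    exists_contDiff_tsupport_subset (n := (⊤ : ℕ∞)) (hΩ.mem_nhds hq0)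
  set F : ℝ × Ed d → Em m := fun q => pt u q - ∑ α, pd α (Wf Ab α u) q with hF
  have hsW := fun α => Wf_smooth hAs α hu
  have hFs : ContDiff ℝ (⊤ : ℕ∞) F :=
    (pt_smooth hu).sub (ContDiff.sum fun α _ => pd_smooth (hsW α) α)
  set φ : ℝ × Ed d → Em m := fun q => χ q • F q with hφ
  have hφs : ContDiff ℝ (⊤ : ℕ∞) φ := hχ3.smul hFs
  have hφc : HasCompactSupport φ := hχ2.smul_right
  have h0 := hw φ hφs hφc ((tsupport_smul_subset_left χ F).trans hχ1)
  have hsm : ∀ {g : ℝ × Ed d → Em m}, ContDiff ℝ (⊤ : ℕ∞) g →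
      ContDiff ℝ (⊤ : ℕ∞) (fun p => (1:ℝ) ^ (0+1) * ⟪g p, φ p⟫) := fun hg =>
    contDiff_const.mul (hg.inner ℝ hφs)
  have hcp : ∀ (g : ℝ × Ed d → Em m), HasCompactSupport (fun p => (1:ℝ) ^ (0+1) * ⟪g p, φ p⟫) := by
    intro g
    refine HasCompactSupport.mul_left ?_
    refine hφc.mono ?_
    intro q hq
    simp only [mem_support] at hq ⊢
    contrapose! hq
    simp [hq]
  have hIntg : ∀ {g : ℝ × Ed d → Em m}, ContDiff ℝ (⊤ : ℕ∞) g → ∀ e,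
      Integrable (fun q => fderiv ℝ (fun p => (1:ℝ) ^ (0+1) * ⟪g p, φ p⟫) q e) := fun hg e =>
    (dir_smooth (hsm hg) e).continuous.integrable_of_hasCompactSupport
      ((hcp _).fderiv_apply ℝ e)
  set G : ℝ × Ed d → ℝ := fun q => pt (fun p => (1:ℝ) ^ (0+1) * ⟪u p, φ p⟫) q
    - ∑ α, pd α (fun p => (1:ℝ) ^ (0+1) * ⟪Wf Ab α u p, φ p⟫) q with hG
  have j1 : Integrable (fun q => pt (fun p => (1:ℝ) ^ (0+1) * ⟪u p, φ p⟫) q) := hIntg hu _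
  have j2 : ∀ α, Integrable (fun q => pd α (fun p => (1:ℝ) ^ (0+1) * ⟪Wf Ab α u p, φ p⟫) q) :=
    fun α => hIntg (hsW α) _
  have hGi : Integrable G := j1.sub (integrable_finsetSum _ fun α _ => j2 α)
  have hG0 : ∫ q, G q = 0 := by
    simp only [hG]
    rw [integral_sub j1 (integrable_finsetSum _ fun α _ => j2 α),
      integral_finsetSum _ (fun α _ => j2 α)]
    have h1 : ∫ q, pt (fun p => (1:ℝ) ^ (0+1) * ⟪u p, φ p⟫) q = 0 :=
      integral_dir_zero (hsm hu) (hcp _) _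
    have h2 : ∀ α, ∫ q, pd α (fun p => (1:ℝ) ^ (0+1) * ⟪Wf Ab α u p, φ p⟫) q = 0 := fun α =>
      integral_dir_zero (hsm (hsW α)) (hcp _) _
    rw [h1, Finset.sum_congr rfl (fun α _ => h2 α)]
    simp
  have hprod : ∀ {g : ℝ × Ed d → Em m}, ContDiff ℝ (⊤ : ℕ∞) g → ∀ e q,
      fderiv ℝ (fun p => (1:ℝ) ^ (0+1) * ⟪g p, φ p⟫) q e =
      ⟪fderiv ℝ g q e, φ q⟫ + ⟪g q, fderiv ℝ φ q e⟫ := by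
    intro g hg e q
    rw [pd_inner (w := fun _ => (1:ℝ)) hg hφs contDiff_const 0 e q]
    simp
  have hpt : ∀ q, ⟪u q, pt φ q⟫ - ∑ α, ∑ β, ⟪Ab α β (q.2 0) (pd β u q), pd α φ q⟫
      = G q - χ q * ‖F q‖ ^ 2 := by
    intro q
    have e1 : pt (fun p => (1:ℝ) ^ (0+1) * ⟪u p, φ p⟫) q = ⟪pt u q, φ q⟫ + ⟪u q, pt φ q⟫ :=
      hprod hu _ q
    have e2 : ∀ α, pd α (fun p => (1:ℝ) ^ (0+1) * ⟪Wf Ab α u p, φ p⟫) q =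
        ⟪pd α (Wf Ab α u) q, φ q⟫ + ⟪Wf Ab α u q, pd α φ q⟫ := fun α => hprod (hsW α) _ q
    have e3 : χ q * ‖F q‖ ^ 2 = ⟪pt u q, φ q⟫ - ∑ α, ⟪pd α (Wf Ab α u) q, φ q⟫ := by
      rw [← sum_inner, ← inner_sub_left]
      change _ = ⟪F q, χ q • F q⟫
      rw [real_inner_smul_right, real_inner_self_eq_norm_sq]
    rw [e3]
    simp only [hG]
    rw [e1, Finset.sum_congr rfl (fun α _ => e2 α), Finset.sum_add_distrib]
    simp only [Wf, sum_inner]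
    ring
  rw [integral_congr_ae (Filter.Eventually.of_forall hpt)] at h0
  have hFc : Continuous (fun q => χ q * ‖F q‖ ^ 2) :=
    hχ3.continuous.mul (hFs.continuous.norm.pow 2)
  have hFcp : HasCompactSupport (fun q => χ q * ‖F q‖ ^ 2) := hχ2.mul_right
  have hFi := hFc.integrable_of_hasCompactSupport (μ := volume) hFcp
  rw [integral_sub hGi hFi, hG0, zero_sub, neg_eq_zero] at h0
  have hnn : ∀ q, 0 ≤ χ q * ‖F q‖ ^ 2 := fun q =>
    mul_nonneg (hχ4 (mem_range_self q)).1 (by positivity)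
  have : (volume : Measure (ℝ × Ed d)).IsAddHaarMeasure := Measure.prod.instIsAddHaarMeasure _ _
  rw [integral_eq_zero_iff_of_nonneg hnn hFi] at h0
  have h1 := (Continuous.ae_eq_iff_eq volume hFc continuous_const).1 h0
  have h2 := congrFun h1 q0
  simp only [hχ5, one_mul] at h2
  have h3 : F q0 = 0 := norm_eq_zero.1 (pow_eq_zero_iff (two_ne_zero) |>.1 h2)
  exact sub_eq_zero.1 h3

lemma young2 (a b : ℝ) {ε : ℝ} (hε : 0 < ε) : a * b ≤ ε * a ^ 2 + 1 / (4 * ε) * b ^ 2 := by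
  have h4 : 0 ≤ (2 * ε * a - b) ^ 2 / (4 * ε) := by positivity
  have h5 : (2 * ε * a - b) ^ 2 / (4 * ε) = ε * a ^ 2 + 1 / (4 * ε) * b ^ 2 - a * b := by
    field_simp; ring
  linarith

lemma Qc0_meas (r : ℝ) : MeasurableSet (Qc0 r : Set (ℝ × Ed d)) :=
  measurableSet_Ioo.prod measurableSet_ball

lemma Qc0_intOn {f : ℝ × Ed d → ℝ} (hf : Continuous f) (r : ℝ) :
    IntegrableOn f (Qc0 r) := by
  refine (hf.continuousOn.integrableOn_compact
    ((isCompact_Icc (a := 0 - r ^ 2) (b := 0)).prod (isCompact_closedBall (0 : Ed d) r))).mono_set ?_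
  exact prod_mono Ioo_subset_Icc_self ball_subset_closedBall

lemma ut_bound [NeZero d] {δ : ℝ} (hδ : 0 < δ) {K : ℝ} (hK : 0 ≤ K) :
    ∃ C : ℝ, 0 < C ∧ ∀ (Ab : Fin d → Fin d → ℝ → CLM m), CoeffsOne δ Ab →
      (∀ α β, ContDiff ℝ (⊤ : ℕ∞) (Ab α β)) →
      ∀ u : ℝ × Ed d → Em m, ContDiff ℝ (⊤ : ℕ∞) u → Sol Ab (Qc0 4) u →
      ∀ η, Cut K η → ∫ q, η q ^ 2 * ‖pt u q‖ ^ 2 ≤ C * ∫ q in Qc0 3, gradSq u q := by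
  obtain ⟨C1, hC1, hcac⟩ := caccioppoli (d := d) (m := m) hδ hK
  have hd : (0:ℝ) < d := by exact_mod_cast Nat.pos_of_ne_zero (NeZero.ne d)
  set M : ℝ := d / δ ^ 2 with hM
  have hMp : 0 < M := by positivity
  set ε : ℝ := 1 / (4 * C1) with hε
  have hεp : 0 < ε := by positivity
  set C0 : ℝ := d * ((4 * d * K ^ 2 + 1 / (4 * ε)) * M) with hC0
  have hC0p : 0 < C0 := by positivity
  refine ⟨2 * C0, by positivity, ?_⟩
  intro Ab hA hAs u hu hs η hη
  have hsW := fun α => Wf_smooth hAs α hu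
  have hut := pt_smooth hu
  have hsut : Sol Ab (Qc0 4) (pt u) :=
    hs.dir hAs (isOpen_Ioo.prod isOpen_ball) hu (1, 0) (by simp)
  have hY := hcac Ab hA hAs (pt u) hut hsut η hη
  have hsm : ∀ {g : ℝ × Ed d → Em m}, ContDiff ℝ (⊤ : ℕ∞) g →
      ContDiff ℝ (⊤ : ℕ∞) (fun p => η p ^ (1+1) * ⟪pt u p, g p⟫) := fun hg =>
    (hη.smooth.pow _).mul (hut.inner ℝ hg)
  set G : ℝ × Ed d → ℝ := fun q =>
    ∑ α, pd α (fun p => η p ^ (1+1) * ⟪pt u p, Wf Ab α u p⟫) q with hG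
  have j2 : ∀ α, Integrable (fun q => pd α (fun p => η p ^ (1+1) * ⟪pt u p, Wf Ab α u p⟫) q) :=
    fun α => (dir_smooth (hsm (hsW α)) _).continuous.integrable_of_hasCompactSupport
      ((hη.compact _ 1).fderiv_apply ℝ _)
  have hGi : Integrable G := integrable_finsetSum _ fun α _ => j2 α
  have hG0 : ∫ q, G q = 0 := by
    simp only [hG]
    rw [integral_finsetSum _ (fun α _ => j2 α)]
    have h2 : ∀ α, ∫ q, pd α (fun p => η p ^ (1+1) * ⟪pt u p, Wf Ab α u p⟫) q = 0 := fun α =>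
      integral_dir_zero (hsm (hsW α)) (hη.compact _ 1) _
    rw [Finset.sum_congr rfl (fun α _ => h2 α)]
    simp
  set Z : ℝ × Ed d → ℝ := (Qc0 3).indicator (gradSq u) with hZ
  have hZn : ∀ q, 0 ≤ Z q := fun q => indicator_nonneg (fun q _ => gradSq_nonneg u q) q
  have hZi : Integrable Z :=
    (integrable_indicator_iff (Qc0_meas 3)).2 (Qc0_intOn (gradSq_cont hu) 3)
  have hZe : ∫ q, Z q = ∫ q in Qc0 3, gradSq u q := integral_indicator (Qc0_meas 3)
  have key : ∀ q, η q ^ 2 * ‖pt u q‖ ^ 2 ≤ G q + 1 / 4 * (η q ^ 2 * ‖pt u q‖ ^ 2)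
      + ε * (η q ^ 4 * gradSq (pt u) q) + C0 * Z q := by
    intro q
    have hGq : G q = ∑ α, (2 * η q * pd α η q * ⟪pt u q, Wf Ab α u q⟫
        + η q ^ 2 * ⟪pd α (pt u) q, Wf Ab α u q⟫) + η q ^ 2 * ‖pt u q‖ ^ 2 := by
      have e2 : ∀ α, pd α (fun p => η p ^ (1+1) * ⟪pt u p, Wf Ab α u p⟫) q =
          2 * η q * pd α η q * ⟪pt u q, Wf Ab α u q⟫
          + η q ^ 2 * ⟪pd α (pt u) q, Wf Ab α u q⟫
          + η q ^ 2 * ⟪pt u q, pd α (Wf Ab α u) q⟫ := by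
        intro α
        refine (pd_inner hut (hsW α) hη.smooth 1 _ q).trans ?_
        unfold pd; norm_num; ring
      have e3 : η q ^ 2 * ‖pt u q‖ ^ 2 = η q ^ 2 * ∑ α, ⟪pt u q, pd α (Wf Ab α u) q⟫ := by
        by_cases h0 : η q = 0
        · simp [h0]
        · rw [← inner_sum, ← hs q (Qc0_mono (by norm_num) (by norm_num) (hη.supp q h0)),
            real_inner_self_eq_norm_sq]
      simp only [hG]
      rw [e3, Finset.sum_congr rfl (fun α _ => e2 α), Finset.sum_add_distrib, Finset.mul_sum]
    by_cases h0 : η q = 0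
    · have := hZn q
      rw [hGq]
      simp only [h0]
      simp
      positivity
    have hZq : Z q = gradSq u q := indicator_of_mem (hη.supp q h0) _
    have hsum : -∑ α, (2 * η q * pd α η q * ⟪pt u q, Wf Ab α u q⟫
        + η q ^ 2 * ⟪pd α (pt u) q, Wf Ab α u q⟫) ≤
        1 / 4 * (η q ^ 2 * ‖pt u q‖ ^ 2)
      + ε * (η q ^ 4 * gradSq (pt u) q) + C0 * Z q := by
      rw [← Finset.sum_neg_distrib]
      calc _ ≤ ∑ α : Fin d, (1 / (4 * d) * (η q ^ 2 * ‖pt u q‖ ^ 2)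
              + ε * η q ^ 4 * ‖pd α (pt u) q‖ ^ 2
              + (4 * d * K ^ 2 + 1 / (4 * ε)) * M * Z q) := by
            refine Finset.sum_le_sum fun α _ => ?_
            have hW := Wf_bound hδ hA α u q
            rw [← hM, ← hZq] at hW
            have hη0 := hη.nonneg q
            have a1 : -(pd α η q * ⟪pt u q, Wf Ab α u q⟫) ≤ K * (‖pt u q‖ * ‖Wf Ab α u q‖) := by
              refine (neg_le_abs _).trans ?_
              rw [abs_mul]
              exact mul_le_mul (hη.pdle α q) (abs_real_inner_le_norm _ _) (abs_nonneg _) hK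
            have a2 : -⟪pd α (pt u) q, Wf Ab α u q⟫ ≤ ‖pd α (pt u) q‖ * ‖Wf Ab α u q‖ :=
              (neg_le_abs _).trans (abs_real_inner_le_norm _ _)
            have b1 := young2 (η q * ‖pt u q‖) (2 * K * ‖Wf Ab α u q‖)
              (ε := 1 / (4 * d)) (by positivity)
            have b2 := young2 (η q ^ 2 * ‖pd α (pt u) q‖) (‖Wf Ab α u q‖) hεp
            have c1 : -(2 * η q * pd α η q * ⟪pt u q, Wf Ab α u q⟫) ≤
                (η q * ‖pt u q‖) * (2 * K * ‖Wf Ab α u q‖) := by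
              have := mul_le_mul_of_nonneg_left a1 (by positivity : 0 ≤ 2 * η q)
              linarith
            have c2 : -(η q ^ 2 * ⟪pd α (pt u) q, Wf Ab α u q⟫) ≤
                (η q ^ 2 * ‖pd α (pt u) q‖) * ‖Wf Ab α u q‖ := by
              have := mul_le_mul_of_nonneg_left a2 (by positivity : 0 ≤ η q ^ 2)
              linarith
            have e1 : 1 / (4 * (1 / (4 * (d:ℝ)))) * (2 * K * ‖Wf Ab α u q‖) ^ 2
                = 4 * d * K ^ 2 * ‖Wf Ab α u q‖ ^ 2 := by field_simp; ring
            rw [e1] at b1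
            have f1 := mul_le_mul_of_nonneg_left hW
              (by positivity : 0 ≤ 4 * d * K ^ 2 + 1 / (4 * ε))
            linarith
        _ = _ := by
            rw [Finset.sum_add_distrib, Finset.sum_add_distrib, ← Finset.mul_sum]
            simp only [Finset.sum_const, Finset.card_univ, Fintype.card_fin, nsmul_eq_mul]
            rw [hC0]
            unfold gradSq
            have : 1 / (4 * (d:ℝ)) * (d * (η q ^ 2 * ‖pt u q‖ ^ 2)) =
              1 / 4 * (η q ^ 2 * ‖pt u q‖ ^ 2) := by field_simp
            rw [this, ← Finset.mul_sum]
            ring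
    rw [hGq]
    linarith
  have i1 : Integrable (fun q => η q ^ 4 * gradSq (pt u) q) := hη.integrable (gradSq_cont hut) 3
  have i2 : Integrable (fun q => η q ^ 2 * ‖pt u q‖ ^ 2) :=
    hη.integrable (hut.continuous.norm.pow 2) 1
  have k1 : Integrable (fun q => G q + 1 / 4 * (η q ^ 2 * ‖pt u q‖ ^ 2)) :=
    hGi.add (i2.const_mul (1/4))
  have k2 : Integrable (fun q => G q + 1 / 4 * (η q ^ 2 * ‖pt u q‖ ^ 2)
      + ε * (η q ^ 4 * gradSq (pt u) q)) := k1.add (i1.const_mul ε)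
  have h' := integral_mono i2 (k2.add (hZi.const_mul C0)) key
  have e := integral_add k2 (hZi.const_mul C0)
  rw [integral_add k1 (i1.const_mul ε), integral_add hGi (i2.const_mul (1/4)),
    integral_const_mul, integral_const_mul, integral_const_mul, hG0, hZe] at e
  replace h' := h'.trans_eq e
  have hY' : ε * ∫ q, η q ^ 4 * gradSq (pt u) q ≤ 1 / 4 * ∫ q, η q ^ 2 * ‖pt u q‖ ^ 2 := by
    calc _ ≤ ε * (C1 * ∫ q, η q ^ 2 * ‖pt u q‖ ^ 2) := by gcongr
      _ = _ := by rw [hε]; field_simp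
  linarith

lemma D1U_bound [NeZero d] {δ : ℝ} (hδ : 0 < δ) {K : ℝ} (hK : 0 ≤ K) :
    ∃ C : ℝ, 0 < C ∧ ∀ (Ab : Fin d → Fin d → ℝ → CLM m), CoeffsOne δ Ab →
      (∀ α β, ContDiff ℝ (⊤ : ℕ∞) (Ab α β)) →
      ∀ u : ℝ × Ed d → Em m, ContDiff ℝ (⊤ : ℕ∞) u → Sol Ab (Qc0 4) u →
      ∀ η, Cut K η →
        ∫ q, η q ^ 4 * ‖pd 0 (Ubar Ab u) q‖ ^ 2 ≤ C * ∫ q in Qc0 3, gradSq u q := by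
  obtain ⟨C1, hC1, hcac⟩ := caccioppoli (d := d) (m := m) hδ hK
  obtain ⟨C2, hC2, hutb⟩ := ut_bound (d := d) (m := m) hδ hK
  have hd : (0:ℝ) < d := by exact_mod_cast Nat.pos_of_ne_zero (NeZero.ne d)
  set M : ℝ := d / δ ^ 2 with hM
  have hMp : 0 < M := by positivity
  refine ⟨2 * C2 + 2 * d * M * (d * C1), by positivity, ?_⟩
  intro Ab hA hAs u hu hs η hη
  set S : Finset (Fin d) := Finset.univ.erase 0 with hS
  have hScard : (S.card : ℝ) ≤ d := by
    have : S.card ≤ d := by simpa using Finset.card_le_univ S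
    exact_mod_cast this
  have hsW := fun α => Wf_smooth hAs α hu
  have hut := pt_smooth hu
  have hX := hutb Ab hA hAs u hu hs η hη
  have hdir : ∀ α ∈ S, ((0, EuclideanSpace.single α 1) : ℝ × Ed d).2 0 = 0 := by
    intro α hα
    have : α ≠ 0 := (Finset.mem_erase.1 hα).1
    simp [this.symm]
  have hI : ∀ α ∈ S, ∫ q, η q ^ 4 * gradSq (pd α u) q ≤ C1 * ∫ q in Qc0 3, gradSq u q := by
    intro α hα
    have h1 : Sol Ab (Qc0 4) (pd α u) :=
      hs.dir hAs (isOpen_Ioo.prod isOpen_ball) hu _ (hdir α hα)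
    refine (hcac Ab hA hAs (pd α u) (pd_smooth hu α) h1 η hη).trans ?_
    refine mul_le_mul_of_nonneg_left ?_ hC1.le
    rw [← integral_indicator (Qc0_meas 3)]
    refine integral_mono (hη.integrable ((pd_smooth hu α).continuous.norm.pow 2) 1)
      ((integrable_indicator_iff (Qc0_meas 3)).2 (Qc0_intOn (gradSq_cont hu) 3)) ?_
    intro q
    by_cases h0 : η q = 0
    · simp only [h0]
      simpa using indicator_nonneg (fun q _ => gradSq_nonneg u q) q
    · simp only [indicator_of_mem (hη.supp q h0)]
      have h2 : ‖pd α u q‖ ^ 2 ≤ gradSq u q :=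
        Finset.single_le_sum (f := fun α => ‖pd α u q‖ ^ 2) (fun _ _ => by positivity)
          (Finset.mem_univ α)
      have h3 : η q ^ 2 ≤ 1 := pow_le_one₀ (hη.nonneg q) (hη.le_one q)
      change η q ^ 2 * ‖pd α u q‖ ^ 2 ≤ _
      nlinarith [sq_nonneg ‖pd α u q‖]
  have key : ∀ q, η q ^ 4 * ‖pd 0 (Ubar Ab u) q‖ ^ 2 ≤ 2 * (η q ^ 2 * ‖pt u q‖ ^ 2)
      + 2 * d * M * ∑ α ∈ S, η q ^ 4 * gradSq (pd α u) q := by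
    intro q
    have hR : 0 ≤ ∑ α ∈ S, η q ^ 4 * gradSq (pd α u) q :=
      Finset.sum_nonneg fun α _ => mul_nonneg (by positivity) (gradSq_nonneg _ _)
    by_cases h0 : η q = 0
    · simp [h0]
    have hq : q ∈ Qc0 4 := Qc0_mono (by norm_num) (by norm_num) (hη.supp q h0)
    have e1 : pd 0 (Ubar Ab u) q = pt u q - ∑ α ∈ S, Wf Ab α (pd α u) q := by
      rw [hs q hq, ← Finset.add_sum_erase _ _ (Finset.mem_univ (0 : Fin d))]
      have : ∑ α ∈ S, Wf Ab α (pd α u) q = ∑ α ∈ S, pd α (Wf Ab α u) q :=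
        Finset.sum_congr rfl fun α hα => (Wf_comm hAs α hu _ q (hdir α hα)).symm
      rw [this, ← hS, add_sub_cancel_right]
      rfl
    have e2 : ‖∑ α ∈ S, Wf Ab α (pd α u) q‖ ^ 2 ≤ d * M * ∑ α ∈ S, gradSq (pd α u) q := by
      calc _ ≤ (∑ α ∈ S, ‖Wf Ab α (pd α u) q‖) ^ 2 := by gcongr; exact norm_sum_le _ _
        _ ≤ S.card * ∑ α ∈ S, ‖Wf Ab α (pd α u) q‖ ^ 2 := sq_sum_le_card_mul_sum_sq
        _ ≤ d * ∑ α ∈ S, M * gradSq (pd α u) q := by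
            gcongr with α hα
            exact Wf_bound hδ hA α _ q
        _ = _ := by rw [← Finset.mul_sum]; ring
    have e3 : ‖pd 0 (Ubar Ab u) q‖ ^ 2 ≤ 2 * ‖pt u q‖ ^ 2
        + 2 * ‖∑ α ∈ S, Wf Ab α (pd α u) q‖ ^ 2 := by
      rw [e1]
      have h1 := norm_sub_le (pt u q) (∑ α ∈ S, Wf Ab α (pd α u) q)
      have h2 := pow_le_pow_left₀ (norm_nonneg _) h1 2
      nlinarith [sq_nonneg (‖pt u q‖ - ‖∑ α ∈ S, Wf Ab α (pd α u) q‖)]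
    have h4 : η q ^ 4 ≤ η q ^ 2 :=
      pow_le_pow_of_le_one (hη.nonneg q) (hη.le_one q) (by norm_num)
    have h5 : η q ^ 4 * ‖pt u q‖ ^ 2 ≤ η q ^ 2 * ‖pt u q‖ ^ 2 := by gcongr
    have h6 := mul_le_mul_of_nonneg_left (e3.trans (by gcongr : _ ≤ 2 * ‖pt u q‖ ^ 2
        + 2 * (d * M * ∑ α ∈ S, gradSq (pd α u) q))) (by positivity : 0 ≤ η q ^ 4)
    rw [← Finset.mul_sum]
    linarith
  have hUs : ContDiff ℝ (⊤ : ℕ∞) (Ubar Ab u) := hsW 0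
  have i0 : Integrable (fun q => η q ^ 4 * ‖pd 0 (Ubar Ab u) q‖ ^ 2) :=
    hη.integrable ((pd_smooth hUs 0).continuous.norm.pow 2) 3
  have i2 : Integrable (fun q => η q ^ 2 * ‖pt u q‖ ^ 2) :=
    hη.integrable (hut.continuous.norm.pow 2) 1
  have i1 : ∀ α, Integrable (fun q => η q ^ 4 * gradSq (pd α u) q) := fun α =>
    hη.integrable (gradSq_cont (pd_smooth hu α)) 3
  have i3 : Integrable (fun q => ∑ α ∈ S, η q ^ 4 * gradSq (pd α u) q) :=
    integrable_finsetSum _ fun α _ => i1 α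
  have h := integral_mono i0 ((i2.const_mul 2).add (i3.const_mul (2 * d * M))) key
  have e := integral_add (i2.const_mul 2) (i3.const_mul (2 * d * M))
  rw [integral_const_mul, integral_const_mul, integral_finsetSum _ (fun α _ => i1 α)] at e
  refine (h.trans_eq e).trans ?_
  have hZ0 : 0 ≤ ∫ q in Qc0 3, gradSq u q := integral_nonneg fun q => gradSq_nonneg u q
  have hsum : ∑ α ∈ S, ∫ q, η q ^ 4 * gradSq (pd α u) q
      ≤ d * (C1 * ∫ q in Qc0 3, gradSq u q) := by
    calc _ ≤ ∑ α ∈ S, C1 * ∫ q in Qc0 3, gradSq u q := Finset.sum_le_sum hI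
      _ = S.card * (C1 * ∫ q in Qc0 3, gradSq u q) := by simp
      _ ≤ _ := by gcongr
  have := mul_le_mul_of_nonneg_left hsum (by positivity : 0 ≤ 2 * d * M)
  linarith

lemma st_deriv_bound : ∃ K : ℝ, ∀ x, deriv Real.smoothTransition x ≤ K := by
  have hc : Continuous (deriv Real.smoothTransition) :=
    (Real.smoothTransition.contDiff (n := 1)).continuous_deriv (by simp)
  have hs : HasCompactSupport (deriv Real.smoothTransition) := by
    refine HasCompactSupport.intro (isCompact_Icc (a := (0:ℝ)) (b := 1)) fun x hx => ?_
    rcases lt_or_ge x 0 with h | h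
    · have : Real.smoothTransition =ᶠ[nhds x] fun _ => (0:ℝ) := by
        filter_upwards [Iio_mem_nhds h] with y hy
        exact Real.smoothTransition.zero_of_nonpos (le_of_lt hy)
      rw [this.deriv_eq]; simp
    · have h1 : 1 < x := by
        by_contra hh
        exact hx ⟨h, not_lt.1 hh⟩
      have : Real.smoothTransition =ᶠ[nhds x] fun _ => (1:ℝ) := by
        filter_upwards [Ioi_mem_nhds h1] with y hy
        exact Real.smoothTransition.one_of_one_le (le_of_lt hy)
      rw [this.deriv_eq]; simp
  obtain ⟨K, hK⟩ := hs.exists_bound_of_continuous hc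
  exact ⟨K, fun x => (Real.le_norm_self _).trans (hK x)⟩

lemma exists_cut (d : ℕ) : ∃ K : ℝ, 0 ≤ K ∧ ∀ s : ℝ, 0 < s →
    ∃ η : ℝ × Ed d → ℝ, Cut K η ∧ ∀ q ∈ Qc0 2, q.1 ≤ -(2 * s) → η q = 1 := by
  let ψ : ContDiffBump (0 : Ed d) := ⟨2, 3, by norm_num, by norm_num⟩
  have hψs : ContDiff ℝ (⊤ : ℕ∞) ψ := ψ.contDiff
  obtain ⟨K1, hK1⟩ := (ψ.hasCompactSupport.fderiv (𝕜 := ℝ)).exists_bound_of_continuous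
    (hψs.continuous_fderiv (by simp))
  obtain ⟨K2, hK2⟩ := st_deriv_bound
  refine ⟨max 0 (max K1 K2), le_max_left _ _, fun s hs => ?_⟩
  set a : ℝ → ℝ := fun t => Real.smoothTransition (t + 5) with ha
  set b : ℝ → ℝ := fun t => Real.smoothTransition (-t / s - 1) with hb
  have hst : ContDiff ℝ (⊤ : ℕ∞) Real.smoothTransition := Real.smoothTransition.contDiff
  have has : ContDiff ℝ (⊤ : ℕ∞) a := hst.comp (contDiff_id.add contDiff_const)
  have hbs : ContDiff ℝ (⊤ : ℕ∞) b :=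
    hst.comp ((contDiff_id.neg.div_const s).sub contDiff_const)
  have ha0 : ∀ t, 0 ≤ a t := fun t => Real.smoothTransition.nonneg _
  have ha1 : ∀ t, a t ≤ 1 := fun t => Real.smoothTransition.le_one _
  have hb0 : ∀ t, 0 ≤ b t := fun t => Real.smoothTransition.nonneg _
  have hb1 : ∀ t, b t ≤ 1 := fun t => Real.smoothTransition.le_one _
  have hbanti : Antitone b := by
    intro x y hxy
    apply Real.smoothTransition.monotone
    have : -y / s ≤ -x / s := by gcongr
    linarith
  have hda : ∀ t, deriv a t ≤ K2 := by
    intro t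
    have : deriv a t = deriv Real.smoothTransition (t + 5) := deriv_comp_add_const _ _ _
    rw [this]; exact hK2 _
  have hdb : ∀ t, deriv b t ≤ 0 := fun t => hbanti.deriv_nonpos
  set c : ℝ → ℝ := fun t => a t * b t with hc
  have hcs : ContDiff ℝ (⊤ : ℕ∞) c := has.mul hbs
  have hc0 : ∀ t, 0 ≤ c t := fun t => mul_nonneg (ha0 t) (hb0 t)
  have hc1 : ∀ t, c t ≤ 1 := fun t => mul_le_one₀ (ha1 t) (hb0 t) (hb1 t)
  have hdc : ∀ t, deriv c t ≤ max 0 K2 := by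
    intro t
    have : deriv c t = deriv a t * b t + a t * deriv b t :=
      deriv_fun_mul (has.differentiable (by simp) t) (hbs.differentiable (by simp) t)
    rw [this]
    have h1 : a t * deriv b t ≤ 0 := mul_nonpos_of_nonneg_of_nonpos (ha0 t) (hdb t)
    have h2 : deriv a t * b t ≤ max 0 K2 * b t :=
      mul_le_mul_of_nonneg_right ((hda t).trans (le_max_right _ _)) (hb0 t)
    have h3 : max 0 K2 * b t ≤ max 0 K2 :=
      mul_le_of_le_one_right (le_max_left _ _) (hb1 t)
    linarith
  have hcne : ∀ t, c t ≠ 0 → -5 < t ∧ t < 0 := by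
    intro t ht
    have h1 : a t ≠ 0 := left_ne_zero_of_mul ht
    have h2 : b t ≠ 0 := right_ne_zero_of_mul ht
    constructor
    · by_contra h
      exact h1 (Real.smoothTransition.zero_of_nonpos (by linarith))
    · by_contra h
      refine h2 (Real.smoothTransition.zero_of_nonpos ?_)
      have : -t / s ≤ 0 := div_nonpos_of_nonpos_of_nonneg (by linarith) hs.le
      linarith
  set η : ℝ × Ed d → ℝ := fun q => c q.1 * ψ q.2 with hη
  have hfd : ∀ q e, fderiv ℝ η q e = deriv c q.1 * e.1 * ψ q.2 + c q.1 * fderiv ℝ ψ q.2 e.2 := by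
    intro q e
    have h1 : HasFDerivAt (fun p : ℝ × Ed d => c p.1) _ q :=
      ((hcs.differentiable (by simp) q.1).hasDerivAt.hasFDerivAt).comp q
        (hasFDerivAt_fst (𝕜 := ℝ) (p := q))
    have h2 : HasFDerivAt (fun p : ℝ × Ed d => ψ p.2) _ q :=
      ((hψs.differentiable (by simp) q.2).hasFDerivAt).comp q (hasFDerivAt_snd (𝕜 := ℝ) (p := q))
    have := congrArg (fun L : (ℝ × Ed d) →L[ℝ] ℝ => L e) (h1.mul h2).fderiv
    refine Eq.trans ?_ (this.trans ?_)
    · rfl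
    · simp
      ring
  have hsupp : ∀ q, η q ≠ 0 → (-5 < q.1 ∧ q.1 < 0) ∧ q.2 ∈ ball (0 : Ed d) 3 := by
    intro q hq
    refine ⟨hcne _ (left_ne_zero_of_mul hq), ?_⟩
    have : q.2 ∈ support ψ := right_ne_zero_of_mul hq
    rwa [ψ.support_eq] at this
  refine ⟨η, ⟨?_, ?_, ?_, ?_, ?_, ?_, ?_⟩, ?_⟩
  · exact (hcs.comp contDiff_fst).mul (hψs.comp contDiff_snd)
  · refine HasCompactSupport.intro ((isCompact_Icc (a := (-5:ℝ)) (b := 0)).prod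
      (isCompact_closedBall (0 : Ed d) 3)) fun q hq => ?_
    by_contra h
    obtain ⟨⟨h1, h2⟩, h3⟩ := hsupp q h
    exact hq ⟨⟨h1.le, h2.le⟩, ball_subset_closedBall h3⟩
  · exact fun q => mul_nonneg (hc0 _) ψ.nonneg
  · exact fun q => mul_le_one₀ (hc1 _) ψ.nonneg ψ.le_one
  · intro q
    unfold pt
    rw [hfd]
    simp only [mul_one, map_zero, mul_zero, add_zero]
    have h2 : deriv c q.1 * ψ q.2 ≤ max 0 K2 * ψ q.2 :=
      mul_le_mul_of_nonneg_right (hdc _) ψ.nonneg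
    have h3 : max 0 K2 * ψ q.2 ≤ max 0 K2 :=
      mul_le_of_le_one_right (le_max_left _ _) ψ.le_one
    have h4 : max 0 K2 ≤ max 0 (max K1 K2) := max_le_max le_rfl (le_max_right _ _)
    linarith
  · intro α q
    unfold pd
    rw [hfd]
    simp only [mul_zero, zero_mul, zero_add]
    rw [abs_mul, abs_of_nonneg (hc0 _)]
    have h1 : |fderiv ℝ ψ q.2 (EuclideanSpace.single α 1)| ≤ K1 := by
      have := (fderiv ℝ ψ q.2).le_opNorm (EuclideanSpace.single α 1)
      simp at this
      exact this.trans (hK1 _)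
    have h2 := mul_le_of_le_one_left (abs_nonneg (fderiv ℝ ψ q.2 (EuclideanSpace.single α 1)))
      (hc1 q.1)
    exact (h2.trans h1).trans ((le_max_left _ _).trans (le_max_right _ _))
  · intro q hq
    obtain ⟨⟨h1, h2⟩, h3⟩ := hsupp q hq
    refine ⟨⟨?_, h2⟩, h3⟩
    linarith
  · rintro q ⟨⟨h1, h2⟩, h3⟩ hqs
    have hψ1 : ψ q.2 = 1 := ψ.one_of_mem_closedBall (ball_subset_closedBall h3)
    have ha' : a q.1 = 1 := Real.smoothTransition.one_of_one_le (by linarith)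
    have hb' : b q.1 = 1 := by
      refine Real.smoothTransition.one_of_one_le ?_
      have : 2 ≤ -q.1 / s := by rw [le_div_iff₀ hs]; linarith
      linarith
    simp [hη, hc, hψ1, ha', hb']

/-- Removing the time truncation. -/
lemma limit_bound {f : ℝ × Ed d → ℝ} (hf : Continuous f) {B : ℝ}
    (h : ∀ s : ℝ, 0 < s → ∫ q in Qc0 2 ∩ {q | q.1 ≤ -(2 * s)}, f q ≤ B) :
    ∫ q in Qc0 2, f q ≤ B := by
  set T : ℕ → Set (ℝ × Ed d) := fun n => Qc0 2 ∩ {q | q.1 ≤ -(2 * (1 / ((n:ℝ) + 1)))} with hT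
  have hU : ⋃ n, T n = Qc0 2 := by
    apply subset_antisymm
    · exact iUnion_subset fun n => inter_subset_left
    · intro q hq
      have h1 : q.1 < 0 := hq.1.2
      obtain ⟨n, hn⟩ := exists_nat_one_div_lt (show 0 < -q.1 / 2 by linarith)
      refine mem_iUnion.2 ⟨n, hq, ?_⟩
      simp only [mem_ofPred_eq]
      linarith
  have hm : ∀ n, MeasurableSet (T n) := fun n =>
    (Qc0_meas 2).inter (measurableSet_le measurable_fst measurable_const)
  have hmono : Monotone T := by
    intro i j hij
    refine inter_subset_inter le_rfl ?_
    intro q hq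
    simp only [mem_ofPred_eq] at hq ⊢
    have : 1 / ((j:ℝ) + 1) ≤ 1 / ((i:ℝ) + 1) := by gcongr
    linarith
  have := tendsto_setIntegral_of_monotone hm hmono (f := f) (μ := volume)
    (by rw [hU]; exact Qc0_intOn hf 2)
  rw [hU] at this
  exact le_of_tendsto' this fun n => h _ (by positivity)

end helpers

/-- For homogeneous systems with smooth coefficients depending only
on `x₁`, setting `U = Σ_β Ā^{1β}(x₁) D_βu`, one has
`‖U‖_{L₂(Q₂)} + ‖D₁U‖_{L₂(Q₂)} ≤ N‖Du‖_{L₂(Q₃)}` with `N = N(d,m,δ)` independent of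
any smoothness norms of `Ā`. -/
theorem stmt_9
    (d m : ℕ) [NeZero d] [NeZero m] (δ : ℝ) (hδ : δ ∈ Set.Ioc (0:ℝ) 1) :
    ∃ N : ℝ, 0 < N ∧
    ∀ (Ab : Fin d → Fin d → ℝ → CLM m), CoeffsOne δ Ab →
      (∀ α β, ContDiff ℝ (⊤ : ℕ∞) (Ab α β)) →
    ∀ u : ℝ × Ed d → Em m, ContDiff ℝ (⊤ : ℕ∞) u →
    -- `-u_t + D_α(Ā^{αβ}(x₁)D_βu) = 0` weakly in `Q₄`
    (∀ φt : ℝ × Ed d → Em m, ContDiff ℝ (⊤ : ℕ∞) φt → HasCompactSupport φt →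
      tsupport φt ⊆ Qc0 4 →
      ∫ q, (⟪u q, pt φt q⟫ - ∑ α, ∑ β, ⟪Ab α β (q.2 0) (pd β u q), pd α φt q⟫) = 0) →
    Real.sqrt (∫ q in Qc0 (d := d) 2, ‖Ubar Ab u q‖ ^ 2)
      + Real.sqrt (∫ q in Qc0 (d := d) 2, ‖pd 0 (Ubar Ab u) q‖ ^ 2)
      ≤ N * Real.sqrt (∫ q in Qc0 (d := d) 3, gradSq u q) := by
  obtain ⟨hδ0, -⟩ := hδ
  obtain ⟨K, hK, hcut⟩ := exists_cut d
  obtain ⟨C, hC, hD⟩ := D1U_bound (d := d) (m := m) hδ0 hK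
  have hd : (0:ℝ) < d := by exact_mod_cast Nat.pos_of_ne_zero (NeZero.ne d)
  have hM : 0 < (d:ℝ) / δ ^ 2 := by positivity
  refine ⟨Real.sqrt (d / δ ^ 2) + Real.sqrt C, by positivity, ?_⟩
  intro Ab hA hAs u hu hw
  have hs : Sol Ab (Qc0 4) u := sol_of_weak hAs hu (isOpen_Ioo.prod isOpen_ball) hw
  have hUs : ContDiff ℝ (⊤ : ℕ∞) (Ubar Ab u) := Wf_smooth hAs 0 hu
  have hsub : (Qc0 2 : Set (ℝ × Ed d)) ⊆ Qc0 3 := Qc0_mono (by norm_num) (by norm_num)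
  have h1 : ∫ q in Qc0 (d := d) 2, ‖Ubar Ab u q‖ ^ 2
      ≤ (d / δ ^ 2) * ∫ q in Qc0 (d := d) 3, gradSq u q := by
    have hgc : Continuous (fun q => (d / δ ^ 2) * gradSq u q) :=
      continuous_const.mul (gradSq_cont hu)
    rw [← integral_const_mul]
    calc _ ≤ ∫ q in Qc0 (d := d) 2, (d / δ ^ 2) * gradSq u q :=
          integral_mono (Qc0_intOn (hUs.continuous.norm.pow 2) 2)
            (Qc0_intOn hgc 2)
            (fun q => Wf_bound hδ0 hA 0 u q)
      _ ≤ _ := setIntegral_mono_set (Qc0_intOn hgc 3)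
            (Filter.Eventually.of_forall fun q => mul_nonneg hM.le (gradSq_nonneg u q))
            hsub.eventuallyLE
  have h2 : ∫ q in Qc0 (d := d) 2, ‖pd 0 (Ubar Ab u) q‖ ^ 2
      ≤ C * ∫ q in Qc0 (d := d) 3, gradSq u q := by
    have hfc : Continuous (fun q => ‖pd 0 (Ubar Ab u) q‖ ^ 2) :=
      (pd_smooth hUs 0).continuous.norm.pow 2
    refine limit_bound hfc fun s hs0 => ?_
    obtain ⟨η, hη, hη1⟩ := hcut s hs0
    refine le_trans ?_ (hD Ab hA hAs u hu hs η hη)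
    have hm : MeasurableSet (Qc0 2 ∩ {q : ℝ × Ed d | q.1 ≤ -(2 * s)}) :=
      (Qc0_meas 2).inter (measurableSet_le measurable_fst measurable_const)
    rw [← integral_indicator hm]
    refine integral_mono ((integrable_indicator_iff hm).2
      ((Qc0_intOn hfc 2).mono_set inter_subset_left)) (hη.integrable hfc 3) fun q => ?_
    by_cases hq : q ∈ Qc0 2 ∩ {q : ℝ × Ed d | q.1 ≤ -(2 * s)}
    · simp only [indicator_of_mem hq, hη1 q hq.1 hq.2]
      simp
    · simp only [indicator_of_notMem hq]
      have := hη.nonneg q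
      positivity
  rw [add_mul, ← Real.sqrt_mul hM.le, ← Real.sqrt_mul hC.le]
  exact add_le_add (Real.sqrt_le_sqrt h1) (Real.sqrt_le_sqrt h2)
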